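/- Let p, q ∈ (1, ∞), let r, s ∈ (0, π_{p,q}/2), and let x, y, u ∈ (0, 1) satisfy arcsin_{p,q}(x) = r, arcsin_{p,q}(y) = s, and arcsin_{p,q}(u) = √(r·s). Then u ≥ √(x·y). (Equivalently, sin_{p,q}(√(r·s)) ≥ √(sin_{p,q}(r) · sin_{p,q}(s)) for all r, s ∈ (0, π_{p,q}/2).) -/

import Mathlib

open MeasureTheory Set

lemma one_sub_rpow_pos {q t : ℝ} (hq : 0 < q) (h0 : 0 ≤ t) (h1 : t < 1) : 0 < 1 - t ^ q :=
  sub_pos.2 (Real.rpow_lt_one h0 h1 hq)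

lemma continuousOn_one_sub_rpow_rpow {q : ℝ} (hq : 0 < q) (e : ℝ) :
    ContinuousOn (fun t : ℝ => (1 - t ^ q) ^ e) (Ico 0 1) := by
  have h : ContinuousOn (fun t : ℝ => 1 - t ^ q) (Ico 0 1) :=
    (continuous_const.sub (Real.continuous_rpow_const hq.le)).continuousOn
  exact h.rpow_const fun t ht => Or.inl (one_sub_rpow_pos hq ht.1 ht.2).ne'

lemma one_sub_rpow_geom_mean_sq_ge {q a b : ℝ} (ha : 0 ≤ a) (hb : 0 ≤ b) :
    (1 - a ^ q) * (1 - b ^ q) ≤ (1 - Real.sqrt (a * b) ^ q) ^ 2 := by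
  have hsq : (Real.sqrt (a * b) ^ q) ^ 2 = a ^ q * b ^ q := by
    rw [sq, ← Real.mul_rpow (Real.sqrt_nonneg _) (Real.sqrt_nonneg _),
      Real.mul_self_sqrt (mul_nonneg ha hb), Real.mul_rpow ha hb]
  have hA := Real.rpow_nonneg ha q
  have hB := Real.rpow_nonneg hb q
  have : 2 * Real.sqrt (a * b) ^ q ≤ a ^ q + b ^ q := by
    refine le_of_abs_le (abs_le_of_sq_le_sq ?_ (by positivity))
    nlinarith [sq_nonneg (a ^ q - b ^ q)]
  nlinarith

/-- The function `t ↦ (1 - t ^ q) ^ (-e)` is multiplicatively midpoint convex on `[0, 1)`. -/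
lemma one_sub_rpow_rpow_neg_geom_mean_sq_le {q e a b : ℝ} (hq : 0 < q) (he : 0 ≤ e)
    (ha : a ∈ Ico (0 : ℝ) 1) (hb : b ∈ Ico (0 : ℝ) 1) :
    ((1 - Real.sqrt (a * b) ^ q) ^ (-e)) ^ 2 ≤ (1 - a ^ q) ^ (-e) * (1 - b ^ q) ^ (-e) := by
  have hA := one_sub_rpow_pos hq ha.1 ha.2
  have hB := one_sub_rpow_pos hq hb.1 hb.2
  have hw : Real.sqrt (a * b) < 1 := by
    rw [Real.sqrt_lt' one_pos]
    nlinarith [ha.1, ha.2, hb.1, hb.2]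
  have hW := one_sub_rpow_pos hq (Real.sqrt_nonneg (a * b)) hw
  rw [sq, ← Real.mul_rpow hW.le hW.le, ← sq, ← Real.mul_rpow hA.le hB.le]
  exact Real.rpow_le_rpow_of_nonpos (mul_pos hA hB)
    (one_sub_rpow_geom_mean_sq_ge ha.1 hb.1) (neg_nonpos.2 he)

/-- Weighted form of the multiplicative midpoint convexity of
`x ↦ ∫ t in 0..x, (1 - t ^ q) ^ (-e)`. -/
lemma integral_one_sub_rpow_geom_mean_le {q e x y c : ℝ} (hq : 0 < q) (he : 0 ≤ e)
    (hx : x ∈ Ioo (0 : ℝ) 1) (hy : y ∈ Ioo (0 : ℝ) 1) (hc : 0 < c) :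
    ∫ t in (0:ℝ)..Real.sqrt (x * y), (1 - t ^ q) ^ (-e) ≤
      (c * (∫ t in (0:ℝ)..x, (1 - t ^ q) ^ (-e)) +
        c⁻¹ * ∫ t in (0:ℝ)..y, (1 - t ^ q) ^ (-e)) / 2 := by
  have hw0 : 0 ≤ Real.sqrt (x * y) := Real.sqrt_nonneg _
  have hw1 : Real.sqrt (x * y) < 1 := by
    rw [Real.sqrt_lt' one_pos]
    nlinarith [hx.1, hx.2, hy.1, hy.2]
  have hww : Real.sqrt (x * y) ^ 2 = x * y := Real.sq_sqrt (mul_pos hx.1 hy.1).le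
  have key : ∀ z : ℝ, ∫ t in (0:ℝ)..z, (1 - t ^ q) ^ (-e) =
      ∫ t in (0:ℝ)..1, z * (1 - (z * t) ^ q) ^ (-e) := by
    intro z
    rw [intervalIntegral.integral_const_mul,
      intervalIntegral.mul_integral_comp_mul_left (f := fun t : ℝ => (1 - t ^ q) ^ (-e))]
    simp
  have hmem : ∀ z : ℝ, 0 ≤ z → z < 1 → ∀ t ∈ Icc (0 : ℝ) 1, z * t ∈ Ico (0 : ℝ) 1 :=
    fun z h0 h1 t ht => ⟨mul_nonneg h0 ht.1, by nlinarith [ht.1, ht.2]⟩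
  have hint : ∀ z : ℝ, 0 ≤ z → z < 1 →
      IntervalIntegrable (fun t : ℝ => z * (1 - (z * t) ^ q) ^ (-e)) volume 0 1 := by
    intro z h0 h1
    apply ContinuousOn.intervalIntegrable
    rw [uIcc_of_le zero_le_one]
    exact continuousOn_const.mul ((continuousOn_one_sub_rpow_rpow hq (-e)).comp
      (continuousOn_const.mul continuousOn_id) (hmem z h0 h1))
  have hix := (hint x hx.1.le hx.2).const_mul c
  have hiy := (hint y hy.1.le hy.2).const_mul c⁻¹
  rw [key, key x, key y, ← intervalIntegral.integral_const_mul,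
    ← intervalIntegral.integral_const_mul, ← intervalIntegral.integral_add hix hiy,
    ← intervalIntegral.integral_div]
  refine intervalIntegral.integral_mono_on zero_le_one (hint _ hw0 hw1)
    ((hix.add hiy).div_const 2) fun t ht => ?_
  have hxt := hmem x hx.1.le hx.2 t ht
  have hyt := hmem y hy.1.le hy.2 t ht
  have hsq := one_sub_rpow_rpow_neg_geom_mean_sq_le hq he hxt hyt
  have hroot : Real.sqrt (x * t * (y * t)) = Real.sqrt (x * y) * t := by
    rw [mul_mul_mul_comm, Real.sqrt_mul (mul_pos hx.1 hy.1).le, Real.sqrt_mul_self ht.1]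
  rw [hroot] at hsq
  have hX := Real.rpow_nonneg (one_sub_rpow_pos hq hxt.1 hxt.2).le (-e)
  have hY := Real.rpow_nonneg (one_sub_rpow_pos hq hyt.1 hyt.2).le (-e)
  generalize (1 - (x * t) ^ q) ^ (-e) = X at *
  generalize (1 - (y * t) ^ q) ^ (-e) = Y at *
  generalize (1 - (Real.sqrt (x * y) * t) ^ q) ^ (-e) = Z at *
  have hx0 := hx.1
  have hy0 := hy.1
  refine le_of_abs_le (abs_le_of_sq_le_sq ?_ (by positivity))
  calc (Real.sqrt (x * y) * Z) ^ 2 = x * y * Z ^ 2 := by rw [mul_pow, hww]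
    _ ≤ x * y * (X * Y) := by gcongr
    _ = c * (x * X) * (c⁻¹ * (y * Y)) := by field_simp
    _ ≤ ((c * (x * X) + c⁻¹ * (y * Y)) / 2) ^ 2 := by
      nlinarith [sq_nonneg (c * (x * X) - c⁻¹ * (y * Y))]

/-- Theorem 1.1(1): for `p, q ∈ (1, ∞)` and `r, s ∈ (0, π_{p,q}/2)`, if
`x, y, u ∈ (0, 1)` satisfy `arcsin_{p,q}(x) = r`, `arcsin_{p,q}(y) = s` and
`arcsin_{p,q}(u) = √(r s)`, then `u ≥ √(x y)`, i.e.
`sin_{p,q}(√(r s)) ≥ √(sin_{p,q}(r) · sin_{p,q}(s))`. -/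
theorem sin_pq_geom_mean (p q : ℝ) (hp : 1 < p) (hq : 1 < q)
    (r s : ℝ)
    (hr : r ∈ Set.Ioo (0 : ℝ) (∫ t in (0:ℝ)..1, (1 - t ^ q) ^ (-(1 / p))))
    (hs : s ∈ Set.Ioo (0 : ℝ) (∫ t in (0:ℝ)..1, (1 - t ^ q) ^ (-(1 / p))))
    (x y u : ℝ) (hx : x ∈ Set.Ioo (0 : ℝ) 1) (hy : y ∈ Set.Ioo (0 : ℝ) 1)
    (hu : u ∈ Set.Ioo (0 : ℝ) 1)
    (hxr : (∫ t in (0:ℝ)..x, (1 - t ^ q) ^ (-(1 / p))) = r)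
    (hys : (∫ t in (0:ℝ)..y, (1 - t ^ q) ^ (-(1 / p))) = s)
    (hurs : (∫ t in (0:ℝ)..u, (1 - t ^ q) ^ (-(1 / p))) = Real.sqrt (r * s)) :
    Real.sqrt (x * y) ≤ u := by
  have hr0 : 0 < r := hr.1
  have hs0 : 0 < s := hs.1
  have hq0 : 0 < q := by linarith
  have hS : 0 < Real.sqrt (r * s) := Real.sqrt_pos.2 (mul_pos hr0 hs0)
  have hSS : Real.sqrt (r * s) ^ 2 = r * s := Real.sq_sqrt (mul_pos hr0 hs0).le
  have hle := integral_one_sub_rpow_geom_mean_le (e := 1 / p) hq0 (by positivity) hx hy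
    (div_pos hS hr0)
  have hmean : (Real.sqrt (r * s) / r * r + (Real.sqrt (r * s) / r)⁻¹ * s) / 2 =
      Real.sqrt (r * s) := by
    field_simp
    linarith
  rw [hxr, hys, hmean, ← hurs] at hle
  by_contra! hlt
  have hw1 : Real.sqrt (x * y) < 1 := by
    rw [Real.sqrt_lt' one_pos]
    nlinarith [hx.1, hx.2, hy.1, hy.2]
  have hint : ∀ a b : ℝ, 0 ≤ a → a ≤ b → b < 1 →
      IntervalIntegrable (fun t : ℝ => (1 - t ^ q) ^ (-(1 / p))) volume a b := by
    intro a b ha hab hb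
    apply ContinuousOn.intervalIntegrable
    rw [uIcc_of_le hab]
    exact (continuousOn_one_sub_rpow_rpow hq0 _).mono
      fun t ht => ⟨ha.trans ht.1, ht.2.trans_lt hb⟩
  have hpos := intervalIntegral.intervalIntegral_pos_of_pos_on
    (hint u _ hu.1.le hlt.le hw1)
    (fun t ht => Real.rpow_pos_of_pos
      (one_sub_rpow_pos hq0 (hu.1.trans ht.1).le (ht.2.trans hw1)) _) hlt
  have hadd := intervalIntegral.integral_add_adjacent_intervals
    (hint 0 u le_rfl hu.1.le hu.2) (hint u _ hu.1.le hlt.le hw1)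
  linarith
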